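/- arXiv:2201.07479 — 2 statements merged into one kernel-verified Lean document; each statement's English description precedes it below -/
import Mathlib

section
/- Let n ≥ 1 and let U ⊆ ℂⁿ be a nonempty connected open set. Let (f_k)_{k∈ℕ} be a sequence of holomorphic functions f_k : U → ℂ such that no f_k vanishes identically on U. Then the zero sets of the f_k do not cover U: there exists a point x ∈ U with f_k(x) ≠ 0 for every k ∈ ℕ. (Equivalently, a nonempty connected open subset of ℂⁿ is not the union of countably many proper zero sets of holomorphic functions.) -/
open Topology Filter

/-- The identity theorem on a convex open set, obtained by restricting to complex lines. -/
theorem DifferentiableOn.eqOn_zero_of_convex_of_eventuallyEq_zero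
    {E F : Type*} [NormedAddCommGroup E] [NormedSpace ℂ E]
    [NormedAddCommGroup F] [NormedSpace ℂ F] [CompleteSpace F]
    {f : E → F} {B : Set E} (hf : DifferentiableOn ℂ f B) (hBopen : IsOpen B)
    (hBconv : Convex ℝ B) {a : E} (ha : a ∈ B) (hfa : f =ᶠ[𝓝 a] 0) :
    Set.EqOn f 0 B := by
  intro y hy
  let L : ℂ → E := fun t => a + t • (y - a)
  have hL : Differentiable ℂ L := by fun_prop
  have hopen : IsOpen (L ⁻¹' B) := hBopen.preimage hL.continuous
  have hconv : Convex ℝ (L ⁻¹' B) := by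
    intro s hs t ht p q hp hq hpq
    have h := hBconv hs ht hp hq hpq
    have hcomb : L (p • s + q • t) = p • L s + q • L t := by
      simp only [L, add_smul, smul_add, smul_assoc]
      rw [add_add_add_comm, ← add_smul, hpq, one_smul]
    rwa [Set.mem_preimage, hcomb]
  have han : AnalyticOnNhd ℂ (f ∘ L) (L ⁻¹' B) :=
    (hf.comp hL.differentiableOn fun _ ht => ht).analyticOnNhd hopen
  have hL0 : L 0 = a := by simp [L]
  have hL1 : L 1 = y := by simp [L]
  have hzero : f ∘ L =ᶠ[𝓝 0] 0 :=
    (show Tendsto L (𝓝 0) (𝓝 a) from hL0 ▸ hL.continuous.tendsto 0).eventually hfa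
  have h := han.eqOn_zero_of_preconnected_of_eventuallyEq_zero hconv.isPreconnected
    (show L 0 ∈ B by rwa [hL0]) hzero (show L 1 ∈ B by rwa [hL1])
  simpa [hL1] using h

/-- The identity theorem for holomorphic functions on a preconnected open subset of a complex
normed space. -/
theorem DifferentiableOn.eqOn_zero_of_preconnected_of_eventuallyEq_zero
    {E F : Type*} [NormedAddCommGroup E] [NormedSpace ℂ E]
    [NormedAddCommGroup F] [NormedSpace ℂ F] [CompleteSpace F]
    {f : E → F} {U : Set E} (hf : DifferentiableOn ℂ f U) (hUopen : IsOpen U)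
    (hU : IsPreconnected U) {a : E} (ha : a ∈ U) (hfa : f =ᶠ[𝓝 a] 0) :
    Set.EqOn f 0 U := by
  have hsub : U ⊆ {x | f =ᶠ[𝓝 x] 0} := by
    refine hU.subset_of_closure_inter_subset isOpen_setOfPred_eventually_nhds ⟨a, ha, hfa⟩ ?_
    rintro x ⟨hxc, hxU⟩
    obtain ⟨r, hr, hball⟩ := Metric.isOpen_iff.mp hUopen x hxU
    obtain ⟨b, hb, hfb⟩ := mem_closure_iff.mp hxc _ Metric.isOpen_ball (Metric.mem_ball_self hr)
    exact ((hf.mono hball).eqOn_zero_of_convex_of_eventuallyEq_zero Metric.isOpen_ball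
      (convex_ball x r) hb hfb).eventuallyEq_of_mem (Metric.ball_mem_nhds x hr)
  exact fun x hx => (hsub hx).self_of_nhds

/-- In a Baire space, countably many relatively open and relatively dense subsets of a nonempty
open set have a common point. -/
theorem IsOpen.exists_forall_mem_of_subset_closure {X ι : Type*} [TopologicalSpace X]
    [BaireSpace X] [Countable ι] {U : Set X} (hU : IsOpen U) (hne : U.Nonempty) {V : ι → Set X}
    (hV : ∀ i, IsOpen (V i)) (hd : ∀ i, U ⊆ closure (V i)) : ∃ x ∈ U, ∀ i, x ∈ V i := by
  have hdense : Dense (⋂ i, (V i ∪ (closure U)ᶜ)) := by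
    refine dense_iInter_of_isOpen (fun i => (hV i).union isClosed_closure.isOpen_compl) fun i x => ?_
    rw [closure_union]
    by_cases hx : x ∈ closure U
    · exact Or.inl (closure_minimal (hd i) isClosed_closure hx)
    · exact Or.inr (subset_closure hx)
  obtain ⟨x, hxU, hx⟩ := hdense.inter_open_nonempty U hU hne
  exact ⟨x, hxU, fun i => (Set.mem_iInter.mp hx i).resolve_right fun h => h (subset_closure hxU)⟩

/-- A nonempty connected open subset of ℂⁿ is not covered by countably many
proper zero sets of holomorphic functions: if no `f k` vanishes identically
on `U`, then some point of `U` avoids all the zero sets. -/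
theorem stmt_0 (n : ℕ) (hn : 1 ≤ n) (U : Set (Fin n → ℂ))
    (hUopen : IsOpen U) (hUconn : IsConnected U)
    (f : ℕ → (Fin n → ℂ) → ℂ)
    (hf : ∀ k, DifferentiableOn ℂ (f k) U)
    (hnz : ∀ k, ∃ x ∈ U, f k x ≠ 0) :
    ∃ x ∈ U, ∀ k, f k x ≠ 0 := by
  obtain ⟨x, hxU, hx⟩ := hUopen.exists_forall_mem_of_subset_closure hUconn.nonempty
    (V := fun k => U ∩ f k ⁻¹' {0}ᶜ)
    (fun k => (hf k).continuousOn.isOpen_inter_preimage hUopen isOpen_compl_singleton)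
    (fun k x hxU => by
      by_contra hx
      obtain ⟨y, hyU, hy⟩ := hnz k
      refine hy ((hf k).eqOn_zero_of_preconnected_of_eventuallyEq_zero hUopen
        hUconn.isPreconnected hxU ?_ hyU)
      filter_upwards [isClosed_closure.isOpen_compl.mem_nhds hx, hUopen.mem_nhds hxU] with z hz hzU
      by_contra hne
      exact hz (subset_closure ⟨hzU, hne⟩))
  exact ⟨x, hxU, fun k => (hx k).2⟩
end

section
/- Let p, m, τ ≥ 1, let α : ℤᵖ → ℂ^τ be an additive group homomorphism, let U ⊆ ℂ^m be a nonempty connected open set, and let λ, λ' : U → ℂ^τ be holomorphic maps. Let K ⊆ U be a subset that is not contained in any countable union of proper zero sets of holomorphic functions on U (i.e., for every sequence (g_j)_{j∈ℕ} of holomorphic functions on U, none vanishing identically on U, K ⊄ ⋃_j Z(g_j)). Assume that for every u ∈ K there exists N_u ∈ ℤᵖ with λ(u) − λ'(u) = α(N_u). Then there exists Ñ ∈ ℤᵖ such that λ(u) = λ'(u) + α(Ñ) for every u ∈ U. -/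
/-- If two holomorphic maps `l, l' : U → ℂ^τ` differ by an element of the
image of `α : ℤᵖ → ℂ^τ` at each point of a subset `K` of `U` that is not
contained in any countable union of proper zero sets of holomorphic functions
on `U`, then they differ by a single `α N₀` on all of `U`. -/
theorem stmt_3 (p m τ : ℕ) (hp : 1 ≤ p) (hm : 1 ≤ m) (hτ : 1 ≤ τ)
    (α : (Fin p → ℤ) →+ (Fin τ → ℂ))
    (U : Set (Fin m → ℂ)) (hUopen : IsOpen U) (hUconn : IsConnected U)
    (l l' : (Fin m → ℂ) → (Fin τ → ℂ))
    (hl : DifferentiableOn ℂ l U) (hl' : DifferentiableOn ℂ l' U)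
    (K : Set (Fin m → ℂ)) (hKU : K ⊆ U)
    (hK : ∀ g : ℕ → (Fin m → ℂ) → ℂ,
      (∀ j, DifferentiableOn ℂ (g j) U) →
      (∀ j, ∃ x ∈ U, g j x ≠ 0) →
      ¬ (K ⊆ ⋃ j, {x ∈ U | g j x = 0}))
    (h : ∀ u ∈ K, ∃ N : Fin p → ℤ, l u - l' u = α N) :
    ∃ N₀ : Fin p → ℤ, ∀ u ∈ U, l u = l' u + α N₀ := by
  by_contra! hne
  have hcoord (N : Fin p → ℤ) : ∃ i, ∃ u ∈ U, l u i - l' u i - α N i ≠ 0 := by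
    obtain ⟨u, hu, hlu⟩ := hne N
    obtain ⟨i, hi⟩ := Function.ne_iff.mp hlu
    exact ⟨i, u, hu, fun h0 => hi (by simp only [Pi.add_apply]; linear_combination h0)⟩
  choose i hi using hcoord
  obtain ⟨e, he⟩ := exists_surjective_nat (Fin p → ℤ)
  refine hK (fun j u => l u (i (e j)) - l' u (i (e j)) - α (e j) (i (e j)))
    (fun j => ((differentiableOn_pi.mp hl _).sub (differentiableOn_pi.mp hl' _)).sub_const _)
    (fun j => hi (e j)) fun u hu => ?_
  obtain ⟨N, hN⟩ := h u hu
  obtain ⟨j, rfl⟩ := he N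
  exact Set.mem_iUnion.mpr ⟨j, hKU hu, sub_eq_zero.mpr (congrFun hN _)⟩
end
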